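/- (Schiebinger–Robeva–Recht lemma, as quoted in the paper) Let $d_1,\ldots,d_r \in \mathbb{N}$ and $s_1 < \cdots < s_r$ be real numbers. The function $t \mapsto \sum_{i=1}^r (a_{i,0} + a_{i,1} t + \cdots + a_{i,2d_i-1} t^{2d_i - 1}) e^{s_i t} + e^{t^2}$ has at most $2(d_1 + \cdots + d_r)$ real zeros, counted with multiplicity. -/

import Mathlib

open scoped BigOperators

namespace SRR
open MeasureTheory ProbabilityTheory Polynomial

/-- at most `n` zeros counted with multiplicity -/
def ZB (f : ℝ → ℝ) (n : ℕ) : Prop :=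
  ∀ (T : Finset ℝ) (m : ℝ → ℕ), (∀ x ∈ T, ∀ l < m x, iteratedDeriv l f x = 0) → ∑ x ∈ T, m x ≤ n

lemma ZB_of_mul {u f : ℝ → ℝ} (hu : ∀ n : ℕ, ContDiff ℝ n u) (hf : ∀ n : ℕ, ContDiff ℝ n f) {n : ℕ}
    (h : ZB (fun t => u t * f t) n) : ZB f n := by
  intro T m hz
  refine h T m fun x hx l hl => ?_
  rw [iteratedDeriv_fun_mul (hu l).contDiffAt (hf l).contDiffAt]
  refine Finset.sum_eq_zero fun i _ => ?_
  rw [hz x hx (l - i) (by omega), mul_zero]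

lemma ZB_rolle {f : ℝ → ℝ} (hf : ContDiff ℝ 1 f) {n : ℕ} (h : ZB (deriv f) n) : ZB f (n + 1) := by
  classical
  intro T m hz
  set S := T.filter (fun x => 0 < m x) with hS
  have hsum : ∑ x ∈ T, m x = ∑ x ∈ S, m x := by
    rw [hS, Finset.sum_filter_of_ne]
    intro x _ hx; omega
  have hfS : ∀ x ∈ S, f x = 0 := by
    intro x hx
    have hx' := Finset.mem_filter.1 hx
    simpa using hz x hx'.1 0 hx'.2
  have hr : ∀ x y : ℝ, ∃ z, x ∈ S → y ∈ S → x < y → (x < z ∧ z < y) ∧ deriv f z = 0 := by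
    intro x y
    by_cases hc : x ∈ S ∧ y ∈ S ∧ x < y
    · obtain ⟨hx, hy, hxy⟩ := hc
      obtain ⟨z, hz1, hz2⟩ := exists_deriv_eq_zero hxy hf.continuous.continuousOn
        ((hfS x hx).trans (hfS y hy).symm)
      exact ⟨z, fun _ _ _ => ⟨hz1, hz2⟩⟩
    · exact ⟨0, fun a b c => absurd ⟨a, b, c⟩ hc⟩
  choose z hzz using hr
  set R := ((S ×ˢ S).filter (fun p => p.1 < p.2)).image (fun p => z p.1 p.2) with hR
  have hcard : S.card ≤ (R \ S).card + 1 := by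
    apply Finset.card_le_sdiff_of_interleaved
    intro x hx y hy hxy _
    refine ⟨z x y, ?_, (hzz x y hx hy hxy).1⟩
    rw [hR]
    exact Finset.mem_image.2 ⟨(x, y), by simp [hx, hy, hxy], rfl⟩
  have hRz : ∀ w ∈ R, deriv f w = 0 := by
    intro w hw
    rw [hR] at hw
    obtain ⟨p, hp, rfl⟩ := Finset.mem_image.1 hw
    simp only [Finset.mem_filter, Finset.mem_product] at hp
    exact (hzz p.1 p.2 hp.1.1 hp.1.2 hp.2).2
  have key := h (S ∪ (R \ S)) (fun x => if x ∈ S then m x - 1 else 1) (by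
    intro x hx l hl
    by_cases hxS : x ∈ S
    · simp only [hxS, if_true] at hl
      rw [← iteratedDeriv_succ']
      exact hz x (Finset.mem_filter.1 hxS).1 (l + 1) (by omega)
    · simp only [hxS, if_false] at hl
      have : l = 0 := by omega
      subst this
      have hxR : x ∈ R := by
        rcases Finset.mem_union.1 hx with h1 | h1
        · exact absurd h1 hxS
        · exact (Finset.mem_sdiff.1 h1).1
      simpa using hRz x hxR)
  rw [Finset.sum_union Finset.disjoint_sdiff] at key
  have e1 : ∑ x ∈ S, (if x ∈ S then m x - 1 else 1) + S.card = ∑ x ∈ S, m x := by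
    rw [Finset.card_eq_sum_ones, ← Finset.sum_add_distrib]
    refine Finset.sum_congr rfl fun x hx => ?_
    have := (Finset.mem_filter.1 hx).2
    simp only [hx, if_true]; omega
  have e2 : ∑ x ∈ R \ S, (if x ∈ S then m x - 1 else 1) = (R \ S).card := by
    rw [Finset.card_eq_sum_ones]
    refine Finset.sum_congr rfl fun x hx => ?_
    simp [(Finset.mem_sdiff.1 hx).2]
  rw [hsum]
  omega

lemma ZB_op {f g : ℝ → ℝ} (s : ℝ) (hf : ∀ n : ℕ, ContDiff ℝ n f) (hg : ∀ n : ℕ, ContDiff ℝ n g)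
    (hd : ∀ t, HasDerivAt f (g t + s * f t) t) {n : ℕ} (h : ZB g n) : ZB f (n + 1) := by
  have hu : ∀ c : ℝ, ∀ n : ℕ, ContDiff ℝ n (fun t : ℝ => Real.exp (c * t)) := by
    intro c n; fun_prop
  apply ZB_of_mul (hu (-s)) hf
  apply ZB_rolle
  · exact_mod_cast (hu (-s) 1).mul (hf 1)
  have e : deriv (fun t => Real.exp (-s * t) * f t) = fun t => Real.exp (-s * t) * g t := by
    funext t
    have h1 : HasDerivAt (fun t => Real.exp (-s * t)) (Real.exp (-s * t) * (-s)) t := by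
      have := ((hasDerivAt_id t).const_mul (-s)).exp
      simpa using this
    rw [(h1.fun_mul (hd t)).deriv]; ring
  rw [e]
  apply ZB_of_mul (hu s) (fun n => (hu (-s) n).mul (hg n))
  have : (fun t => Real.exp (s * t) * (Real.exp (-s * t) * g t)) = g := by
    funext t
    rw [← mul_assoc, ← Real.exp_add]; simp
  rwa [this]

noncomputable def μ0 : Measure ℝ := gaussianReal 0 2

noncomputable def G (q : ℝ[X]) (t : ℝ) : ℝ := ∫ x, q.eval x * Real.exp (t * x) ∂μ0

lemma mem_int (t : ℝ) : t ∈ interior (integrableExpSet id μ0) := by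
  simp [μ0]

lemma G_int (q : ℝ[X]) (t : ℝ) : Integrable (fun x => q.eval x * Real.exp (t * x)) μ0 := by
  induction q using Polynomial.induction_on' with
  | add p q hp hq => simp only [eval_add, add_mul]; exact hp.add hq
  | monomial n a =>
    have := (integrable_pow_mul_exp_of_mem_interior_integrableExpSet (mem_int t) n).const_mul a
    simpa [mul_assoc] using this

lemma G_add (p q : ℝ[X]) (t : ℝ) : G (p + q) t = G p t + G q t := by
  unfold G
  rw [← integral_add (G_int p t) (G_int q t)]
  simp [add_mul]

lemma G_C_mul (c : ℝ) (q : ℝ[X]) (t : ℝ) : G (C c * q) t = c * G q t := by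
  unfold G
  rw [← integral_const_mul]
  simp [mul_assoc]

lemma G_deriv (q : ℝ[X]) (t : ℝ) : HasDerivAt (G q) (G (X * q) t) t := by
  induction q using Polynomial.induction_on' with
  | add p q hp hq =>
    rw [mul_add, G_add]
    have : G (p + q) = fun t => G p t + G q t := by funext t; exact G_add p q t
    rw [this]
    exact hp.add hq
  | monomial n a =>
    have := (hasDerivAt_integral_pow_mul_exp_real (mem_int t) n).const_mul a
    have e : ∀ k, ∀ t, G (monomial k a) t = a * ∫ x, (id x) ^ k * Real.exp (t * id x) ∂μ0 := by
      intro k t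
      unfold G
      rw [← integral_const_mul]
      simp [mul_assoc]
    rw [X_mul_monomial, e, funext (e n)]
    exact this

lemma G_smooth (n : ℕ) (q : ℝ[X]) : ContDiff ℝ n (G q) := by
  induction n generalizing q with
  | zero =>
    exact contDiff_zero.2 (continuous_iff_continuousAt.2 fun t => (G_deriv q t).continuousAt)
  | succ n ih =>
    push_cast
    rw [contDiff_succ_iff_deriv]
    refine ⟨fun t => (G_deriv q t).differentiableAt, by simp, ?_⟩
    rw [show deriv (G q) = G (X * q) from funext fun t => (G_deriv q t).deriv]
    exact ih _

lemma G_one (t : ℝ) : G 1 t = Real.exp (t ^ 2) := by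
  have := mgf_gaussianReal (p := μ0) (X := id) (μ := 0) (v := 2) (by simp [μ0]) t
  simp only [mgf, id] at this
  simp [G, this]

lemma G_pos (q : ℝ[X]) (hq : q ≠ 0) (h0 : ∀ x, 0 ≤ q.eval x) (t : ℝ) : 0 < G q t := by
  unfold G
  rw [integral_pos_iff_support_of_nonneg (fun x => mul_nonneg (h0 x) (Real.exp_pos _).le) (G_int q t)]
  rw [pos_iff_ne_zero]
  intro hc
  have hfin : μ0 {x | q.IsRoot x} = 0 := by
    have : NullSingletonClass μ0 := nullSingletonClass_gaussianReal (by norm_num)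
    exact (Polynomial.finite_setOfPred_isRoot hq).measure_zero μ0
  have huniv : μ0 Set.univ = 0 := by
    refine measure_mono_null ?_ (measure_union_null hc hfin)
    intro x _
    by_cases hx : q.eval x = 0
    · exact Or.inr hx
    · exact Or.inl (mul_ne_zero hx (Real.exp_pos _).ne')
  have : IsProbabilityMeasure μ0 := by unfold μ0; infer_instance
  simp at huniv

noncomputable def F {r : ℕ} (s : Fin r → ℝ) (p : Fin r → ℝ[X]) (q : ℝ[X]) (t : ℝ) : ℝ :=
  (∑ i, (p i).eval t * Real.exp (s i * t)) + G q t

lemma F_smooth {r : ℕ} (s : Fin r → ℝ) (p : Fin r → ℝ[X]) (q : ℝ[X]) (n : ℕ) :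
    ContDiff ℝ n (F s p q) := by
  unfold F
  refine ContDiff.add (ContDiff.sum fun i _ => ?_) (G_smooth n q)
  have := (p i).contDiff_aeval (𝕜 := ℝ) (n : WithTop ℕ∞)
  exact ContDiff.mul (by simpa using this) (by fun_prop)

lemma F_deriv {r : ℕ} (s : Fin r → ℝ) (p : Fin r → ℝ[X]) (q : ℝ[X]) (c t : ℝ) :
    HasDerivAt (F s p q)
      (F s (fun j => derivative (p j) + C (s j - c) * p j) ((X - C c) * q) t + c * F s p q t) t := by
  have h1 : HasDerivAt (F s p q) ((∑ i, ((derivative (p i)).eval t * Real.exp (s i * t) +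
      (p i).eval t * (Real.exp (s i * t) * s i))) + G (X * q) t) t := by
    unfold F
    refine HasDerivAt.add (HasDerivAt.fun_sum fun i _ => ?_) (G_deriv q t)
    have h2 : HasDerivAt (fun t => Real.exp (s i * t)) (Real.exp (s i * t) * s i) t := by
      simpa using ((hasDerivAt_id t).const_mul (s i)).exp
    exact ((p i).hasDerivAt t).mul h2
  convert h1 using 1
  have e : (X - C c) * q = X * q + C (-c) * q := by rw [C_neg]; ring
  unfold F
  rw [e, G_add, G_C_mul, mul_add, Finset.mul_sum]
  have : ∀ A B D E H : ℝ, A + B = D → A + (E + -c * H) + (B + c * H) = D + E := by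
    intros; linarith
  apply this
  rw [← Finset.sum_add_distrib]
  refine Finset.sum_congr rfl fun i _ => ?_
  simp; ring

lemma main {r : ℕ} (s : Fin r → ℝ) (N : ℕ) : ∀ (n : Fin r → ℕ) (p : Fin r → ℝ[X]) (q : ℝ[X]),
    ∑ i, n i = N → (∀ i, ∀ k, n i ≤ k → (p i).coeff k = 0) →
    q * ∏ i, (X - C (s i)) ^ n i ≠ 0 →
    (∀ x, 0 ≤ (q * ∏ i, (X - C (s i)) ^ n i).eval x) → ZB (F s p q) N := by
  classical
  induction N with
  | zero =>
    intro n p q hn hp hq hpos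
    have hn0 : ∀ i, n i = 0 := by simpa using hn
    have hp0 : ∀ i, p i = 0 := by
      intro i; ext k; simpa using hp i k (by simp [hn0 i])
    simp only [hn0, pow_zero, Finset.prod_const_one, mul_one] at hq hpos
    intro T m hz
    rw [Finset.sum_eq_zero]
    intro x hx
    by_contra hm
    have := hz x hx 0 (by omega)
    have h2 := G_pos q hq hpos x
    simp [F, hp0] at this
    linarith
  | succ N ih =>
    intro n p q hn hp hq hpos
    obtain ⟨i, hi⟩ : ∃ i, n i ≠ 0 := by
      by_contra! hc
      simp [hc] at hn
    obtain ⟨k, hk⟩ := Nat.exists_eq_succ_of_ne_zero hi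
    have hprod : (X - C (s i)) * q * ∏ j, (X - C (s j)) ^ (Function.update n i k j) =
        q * ∏ j, (X - C (s j)) ^ n j := by
      rw [← Finset.mul_prod_erase _ _ (Finset.mem_univ i),
        ← Finset.mul_prod_erase _ (fun j => (X - C (s j)) ^ n j) (Finset.mem_univ i),
        Finset.prod_congr rfl (g := fun j => (X - C (s j)) ^ n j)]
      · simp [hk, pow_succ]; ring
      · intro j hj
        simp [Function.update_of_ne (Finset.ne_of_mem_erase hj)]
    refine ZB_op (s i) (F_smooth s p q) (F_smooth s _ _) (F_deriv s p q (s i)) ?_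
    refine ih (Function.update n i k) _ _ ?_ ?_ ?_ ?_
    · rw [← Finset.add_sum_erase _ _ (Finset.mem_univ i)] at hn ⊢
      rw [Finset.sum_congr rfl (g := fun x => n x)]
      · simp only [hk] at hn; simp only [Function.update_self]; omega
      · intro j hj
        simp [Function.update_of_ne (Finset.ne_of_mem_erase hj)]
    · intro j l hl
      by_cases hj : j = i
      · subst hj
        simp at hl
        simp [coeff_derivative, hp j (l + 1) (by omega)]
      · rw [Function.update_of_ne hj] at hl
        simp only [coeff_add, coeff_derivative, coeff_C_mul]
        rw [hp j (l + 1) (by omega), hp j l hl]; simp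
    · rwa [hprod]
    · rwa [hprod]

end SRR



/-- Lemma 4.3 of the paper (Schiebinger–Robeva–Recht): the function
`t ↦ ∑ᵢ (aᵢ₀ + aᵢ₁ t + ⋯ + aᵢ,(2dᵢ-1) t^{2dᵢ-1}) e^{sᵢ t} + e^{t²}` has at most
`2(d₁ + ⋯ + d_r)` real zeros counted with multiplicity. -/
theorem stmt14 (r : ℕ) (d : Fin r → ℕ) (s : Fin r → ℝ) (hs : StrictMono s)
    (a : Fin r → ℕ → ℝ) (T : Finset ℝ) (m : ℝ → ℕ)
    (hzero : ∀ x ∈ T, ∀ l < m x,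
      iteratedDeriv l (fun t =>
        (∑ i, (∑ k ∈ Finset.range (2 * d i), a i k * t ^ k) * Real.exp (s i * t)) +
          Real.exp (t ^ 2)) x = 0) :
    ∑ x ∈ T, m x ≤ 2 * ∑ i, d i := by
  classical
  have h := SRR.main s (∑ i, 2 * d i) (fun i => 2 * d i)
    (fun i => ∑ k ∈ Finset.range (2 * d i), Polynomial.monomial k (a i k)) 1 rfl
    (by
      intro i k hk
      simp only [Polynomial.finsetSum_coeff, Polynomial.coeff_monomial]
      refine Finset.sum_eq_zero fun l hl => ?_
      have := Finset.mem_range.1 hl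
      rw [if_neg (by omega)])
    (by
      rw [one_mul]
      exact Finset.prod_ne_zero_iff.2 fun i _ => pow_ne_zero _ (Polynomial.X_sub_C_ne_zero _))
    (by
      intro x
      rw [one_mul, Polynomial.eval_prod]
      refine Finset.prod_nonneg fun i _ => ?_
      rw [Polynomial.eval_pow, pow_mul]
      positivity)
  rw [Finset.mul_sum]
  refine h T m ?_
  have e : SRR.F s (fun i => ∑ k ∈ Finset.range (2 * d i), Polynomial.monomial k (a i k)) 1 =
      (fun t => (∑ i, (∑ k ∈ Finset.range (2 * d i), a i k * t ^ k) * Real.exp (s i * t)) +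
          Real.exp (t ^ 2)) := by
    funext t
    simp [SRR.F, SRR.G_one, Polynomial.eval_finsetSum]
  rw [e]
  exact hzero
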